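/- arXiv:math/0012035 — 2 statements merged into one kernel-verified Lean document; each statement's English description precedes it below -/
import Mathlib

section
/- Let X ∈ sp(2n,ℝ) satisfy XΩ = ΩX (i.e., X lies in the unitary subalgebra 𝔨). Then the following are equivalent: (1) the centralizer {S ∈ Sp(2n,ℝ) : SX = XS} is compact; (2) the only W ∈ sp(2n,ℝ) with WΩ = -ΩW and XW = WX is W = 0; (3) the linear map W ↦ XW - WX from 𝔰 = {W ∈ sp(2n,ℝ) : WΩ = -ΩW} to itself is bijective. -/
open Matrix

/-- The standard symplectic form matrix `Ω = [[0, Iₙ], [-Iₙ, 0]]` on `ℝ²ⁿ`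
(coordinates indexed by `Fin n ⊕ Fin n`). -/
noncomputable def Omega (n : ℕ) : Matrix (Fin n ⊕ Fin n) (Fin n ⊕ Fin n) ℝ :=
  Matrix.fromBlocks 0 1 (-1) 0

/-- The real symplectic group `Sp(2n, ℝ) = {S : Sᵀ Ω S = Ω}`. -/
noncomputable def Sp (n : ℕ) : Set (Matrix (Fin n ⊕ Fin n) (Fin n ⊕ Fin n) ℝ) :=
  {S | Sᵀ * Omega n * S = Omega n}

/-- The symplectic Lie algebra `sp(2n, ℝ) = {X : Xᵀ Ω + Ω X = 0}`. -/
noncomputable def sp (n : ℕ) : Set (Matrix (Fin n ⊕ Fin n) (Fin n ⊕ Fin n) ℝ) :=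
  {X | Xᵀ * Omega n + Omega n * X = 0}

section Omega

variable {n : ℕ}

theorem Omega_mul_self : Omega n * Omega n = -1 := by
  simp [Omega, fromBlocks_multiply, ← fromBlocks_one, fromBlocks_neg]

theorem Omega_mul_cancel_left (A : Matrix (Fin n ⊕ Fin n) (Fin n ⊕ Fin n) ℝ) :
    Omega n * (Omega n * A) = -A := by
  rw [← mul_assoc, Omega_mul_self, neg_one_mul]

theorem transpose_Omega : (Omega n)ᵀ = -Omega n := by
  simp [Omega, fromBlocks_transpose, fromBlocks_neg]

theorem eq_of_mul_Omega_eq {A B : Matrix (Fin n ⊕ Fin n) (Fin n ⊕ Fin n) ℝ}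
    (h : A * Omega n = B * Omega n) : A = B := by
  have := congrArg (· * Omega n) h
  simpa [mul_assoc, Omega_mul_self] using this

/-- Elements of the unitary subalgebra are antisymmetric. -/
theorem transpose_eq_neg_of_mem_sp {X : Matrix (Fin n ⊕ Fin n) (Fin n ⊕ Fin n) ℝ}
    (hX : X ∈ sp n) (hXk : X * Omega n = Omega n * X) : Xᵀ = -X := by
  apply eq_of_mul_Omega_eq
  rw [neg_mul, hXk]
  exact eq_neg_of_add_eq_zero_left hX

/-- A matrix anticommuting with `Ω` lies in `sp` if and only if it is symmetric. -/
theorem mem_sp_iff_isSymm {W : Matrix (Fin n ⊕ Fin n) (Fin n ⊕ Fin n) ℝ}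
    (hW : W * Omega n = -(Omega n * W)) : W ∈ sp n ↔ W.IsSymm := by
  constructor
  · intro h
    apply eq_of_mul_Omega_eq
    rw [hW]
    exact eq_neg_of_add_eq_zero_left h
  · intro h
    change Wᵀ * Omega n + Omega n * W = 0
    rw [h.eq, hW, neg_add_cancel]

variable (n) in
/-- The noncompact part `𝔰` of the Cartan decomposition, as a subspace. -/
def cartanNoncompact : Submodule ℝ (Matrix (Fin n ⊕ Fin n) (Fin n ⊕ Fin n) ℝ) where
  carrier := {W ∈ sp n | W * Omega n = -(Omega n * W)}
  add_mem' := by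
    rintro A B ⟨hA, hA'⟩ ⟨hB, hB'⟩
    have h : (A + B) * Omega n = -(Omega n * (A + B)) := by
      rw [add_mul, mul_add, hA', hB', neg_add]
    exact ⟨(mem_sp_iff_isSymm h).2
      (((mem_sp_iff_isSymm hA').1 hA).add ((mem_sp_iff_isSymm hB').1 hB)), h⟩
  zero_mem' := by simp [sp]
  smul_mem' := by
    rintro c A ⟨hA, hA'⟩
    have h : (c • A) * Omega n = -(Omega n * (c • A)) := by
      rw [smul_mul_assoc, mul_smul_comm, hA', smul_neg]
    exact ⟨(mem_sp_iff_isSymm h).2 (((mem_sp_iff_isSymm hA').1 hA).smul c), h⟩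

theorem commutator_mem_cartanNoncompact {X W : Matrix (Fin n ⊕ Fin n) (Fin n ⊕ Fin n) ℝ}
    (hX : X ∈ sp n) (hXk : X * Omega n = Omega n * X) (hW : W ∈ cartanNoncompact n) :
    X * W - W * X ∈ cartanNoncompact n := by
  obtain ⟨hW, hW'⟩ := hW
  have h : (X * W - W * X) * Omega n = -(Omega n * (X * W - W * X)) := by
    calc (X * W - W * X) * Omega n = X * (W * Omega n) - W * (X * Omega n) := by noncomm_ring
      _ = -((X * Omega n) * W) - (W * Omega n) * X := by
        rw [hXk, ← mul_assoc W, hW', mul_neg, ← mul_assoc X, hXk]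
      _ = -(Omega n * (X * W - W * X)) := by rw [hW', hXk]; noncomm_ring
  refine ⟨(mem_sp_iff_isSymm h).2 ?_, h⟩
  rw [IsSymm, transpose_sub, transpose_mul, transpose_mul, transpose_eq_neg_of_mem_sp hX hXk,
    ((mem_sp_iff_isSymm hW').1 hW).eq]
  noncomm_ring

theorem isClosed_centralizer_Sp (X : Matrix (Fin n ⊕ Fin n) (Fin n ⊕ Fin n) ℝ) :
    IsClosed {S ∈ Sp n | S * X = X * S} := by
  apply IsClosed.inter
  · exact isClosed_eq (f := fun S => Sᵀ * Omega n * S) (by fun_prop) continuous_const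
  · exact isClosed_eq (f := fun S => S * X) (by fun_prop) (by fun_prop)

/-- If no nonzero element of `𝔰` commutes with `X`, the symplectic centralizer of `X` consists of
orthogonal matrices. -/
theorem transpose_mul_self_of_mem_centralizer {X S : Matrix (Fin n ⊕ Fin n) (Fin n ⊕ Fin n) ℝ}
    (hX : X ∈ sp n) (hXk : X * Omega n = Omega n * X)
    (h : ∀ W ∈ sp n, W * Omega n = -(Omega n * W) → X * W = W * X → W = 0)
    (hS : S ∈ Sp n) (hSX : S * X = X * S) : Sᵀ * S = 1 := by
  have hXt := transpose_eq_neg_of_mem_sp hX hXk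
  have hS' : Sᵀ * Omega n * S = Omega n := hS
  have hSXt : X * Sᵀ = Sᵀ * X := by
    have := congrArg transpose hSX
    rw [transpose_mul, transpose_mul, hXt] at this
    simpa using this
  -- `Sᵀ` is symplectic as well
  have hSt : S * Omega n * Sᵀ = Omega n := by
    have h1 : (-(Omega n * Sᵀ * Omega n)) * S = 1 := by
      rw [neg_mul, mul_assoc, mul_assoc, ← mul_assoc Sᵀ, hS', Omega_mul_self, neg_neg]
    have h2 := mul_eq_one_comm.1 h1
    apply eq_of_mul_Omega_eq
    rw [Omega_mul_self, ← h2]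
    noncomm_ring
  set P := Sᵀ * S with hP
  have hPt : Pᵀ = P := by simp [hP]
  have hPX : X * P = P * X := by
    rw [hP, ← mul_assoc, hSXt, mul_assoc, mul_assoc, hSX]
  have hPP : P * Omega n * P = Omega n := by
    calc P * Omega n * P = Sᵀ * (S * Omega n * Sᵀ) * S := by simp only [hP, mul_assoc]
      _ = Omega n := by rw [hSt, hS']
  have hanti : (P + Omega n * P * Omega n) * Omega n
      = -(Omega n * (P + Omega n * P * Omega n)) := by
    simp only [add_mul, mul_add, mul_assoc, Omega_mul_self, Omega_mul_cancel_left]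
    noncomm_ring
  have hW : P + Omega n * P * Omega n = 0 := by
    refine h _ ((mem_sp_iff_isSymm hanti).2 ?_) hanti ?_
    · simp [IsSymm, hPt, transpose_Omega, mul_assoc]
    · rw [mul_add, add_mul, hPX]
      congr 1
      calc X * (Omega n * P * Omega n) = (X * Omega n) * P * Omega n := by simp only [mul_assoc]
        _ = Omega n * (X * P) * Omega n := by rw [hXk]; simp only [mul_assoc]
        _ = Omega n * P * (X * Omega n) := by rw [hPX]; simp only [mul_assoc]
        _ = Omega n * P * Omega n * X := by rw [hXk]; simp only [mul_assoc]
  have hsq : P * P = 1 := by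
    have h1 : P = -(Omega n * P * Omega n) := eq_neg_of_add_eq_zero_left hW
    calc P * P = -(Omega n * P * Omega n) * P := by rw [← h1]
      _ = -(Omega n * (P * Omega n * P)) := by noncomm_ring
      _ = 1 := by rw [hPP, Omega_mul_self, neg_neg]
  have hpos : P.PosSemidef := by
    simpa [conjTranspose_eq_transpose_of_trivial] using posSemidef_conjTranspose_mul_self S
  have hunit : IsUnit (1 + P) := (PosDef.one.add_posSemidef hpos).isUnit
  have hz : (1 + P) * (P - 1) = 0 := by
    rw [add_mul, mul_sub P, hsq]
    noncomm_ring
  exact sub_eq_zero.1 ((hunit.mul_right_eq_zero).1 hz)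

/-- The exponential of an element of `𝔰` is symplectic. -/
theorem exp_mem_Sp {W : Matrix (Fin n ⊕ Fin n) (Fin n ⊕ Fin n) ℝ}
    (hW : W ∈ cartanNoncompact n) : NormedSpace.exp W ∈ Sp n := by
  obtain ⟨hW, hW'⟩ := hW
  have hsymm := (mem_sp_iff_isSymm hW').1 hW
  have hinv : (Omega n)⁻¹ = -Omega n := inv_eq_left_inv (by rw [neg_mul, Omega_mul_self, neg_neg])
  have hu : IsUnit (Omega n) :=
    IsUnit.of_mul_eq_one (-Omega n) (by rw [mul_neg, Omega_mul_self, neg_neg])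
  have h1 : Omega n * NormedSpace.exp W * (Omega n)⁻¹ = (NormedSpace.exp W)⁻¹ := by
    rw [← exp_conj _ _ hu, ← exp_neg, hinv, mul_neg, ← neg_eq_iff_eq_neg.2 hW']
    simp [mul_assoc, Omega_mul_self]
  have hdet : IsUnit (NormedSpace.exp W).det := (isUnit_iff_isUnit_det _).1 (isUnit_exp W)
  change (NormedSpace.exp W)ᵀ * Omega n * NormedSpace.exp W = Omega n
  rw [← exp_transpose, hsymm.eq]
  have h2 : Omega n * NormedSpace.exp W = (NormedSpace.exp W)⁻¹ * Omega n := by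
    rw [← h1, mul_assoc, nonsing_inv_mul _ ((isUnit_iff_isUnit_det _).1 hu), mul_one]
  rw [mul_assoc, h2, ← mul_assoc, mul_nonsing_inv _ hdet, one_mul]

end Omega

/-- A real symmetric matrix generating a one-parameter group with relatively compact image
vanishes. -/
theorem Matrix.IsSymm.eq_zero_of_exp_mem_isCompact {m : Type*} [Fintype m] [DecidableEq m]
    {W : Matrix m m ℝ} (hW : W.IsSymm) {K : Set (Matrix m m ℝ)} (hK : IsCompact K)
    (h : ∀ t : ℝ, NormedSpace.exp (t • W) ∈ K) : W = 0 := by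
  have hH : W.IsHermitian := by
    rw [IsHermitian, conjTranspose_eq_transpose_of_trivial, hW.eq]
  rw [← hH.eigenvalues_eq_zero_iff]
  funext i
  by_contra hi
  let U : Matrix m m ℝ := hH.eigenvectorUnitary.1
  have hUU : star U * U = 1 := Unitary.coe_star_mul_self _
  have hinv : U⁻¹ = star U := inv_eq_left_inv hUU
  have hunit : IsUnit U := IsUnit.of_mul_eq_one_right _ hUU
  have hdiag : U⁻¹ * W * U = diagonal hH.eigenvalues := by
    have := hH.conjStarAlgAut_star_eigenvectorUnitary
    rw [Unitary.conjStarAlgAut_star_apply] at this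
    rw [hinv]
    exact this
  have hcomp (t : ℝ) : (U⁻¹ * NormedSpace.exp (t • W) * U) i i
      = Real.exp (t * hH.eigenvalues i) := by
    rw [← exp_conj' _ _ hunit, mul_smul_comm, smul_mul_assoc, hdiag, ← diagonal_smul,
      exp_diagonal, diagonal_apply_eq, Pi.coe_exp, Real.exp_eq_exp_ℝ]
    rfl
  obtain ⟨C, hC⟩ := (hK.image (f := fun S : Matrix m m ℝ => (U⁻¹ * S * U) i i)
    (by fun_prop)).bddAbove
  have hle : Real.exp (C / hH.eigenvalues i * hH.eigenvalues i) ≤ C := by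
    rw [← hcomp]
    exact hC ⟨_, h _, rfl⟩
  rw [div_mul_cancel₀ _ hi] at hle
  linarith [Real.add_one_le_exp C]

/-- For `X` in the unitary subalgebra `𝔨` of `sp(2n,ℝ)` (i.e.
`X Ω = Ω X`), the following are equivalent: (1) the centralizer of `X` in `Sp(2n,ℝ)`
is compact; (2) no nonzero `W ∈ 𝔰 = {W ∈ sp : WΩ = -ΩW}` commutes with `X`;
(3) `ad(X) : W ↦ XW - WX` is a bijection of `𝔰` onto itself. -/
theorem stronglyStable_in_unitary_subalgebra_tfae (n : ℕ)
    (X : Matrix (Fin n ⊕ Fin n) (Fin n ⊕ Fin n) ℝ)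
    (hX : X ∈ sp n) (hXk : X * Omega n = Omega n * X) :
    (IsCompact {S ∈ Sp n | S * X = X * S} ↔
      (∀ W ∈ sp n, W * Omega n = -(Omega n * W) → X * W = W * X → W = 0)) ∧
    ((∀ W ∈ sp n, W * Omega n = -(Omega n * W) → X * W = W * X → W = 0) ↔
      Set.BijOn (fun W => X * W - W * X)
        {W ∈ sp n | W * Omega n = -(Omega n * W)}
        {W ∈ sp n | W * Omega n = -(Omega n * W)}) := by
  refine ⟨⟨fun hK W hW hW' hXW => ?_, fun h => ?_⟩, ⟨fun h => ?_, fun h W hW hW' hXW => ?_⟩⟩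
  · refine ((mem_sp_iff_isSymm hW').1 hW).eq_zero_of_exp_mem_isCompact hK fun t => ⟨?_, ?_⟩
    · exact exp_mem_Sp ((cartanNoncompact n).smul_mem t ⟨hW, hW'⟩)
    · have hc : Commute X (t • W) := Commute.smul_right hXW t
      exact hc.exp_right.symm.eq
  · refine IsCompact.of_isClosed_subset
      (isCompact_univ_pi fun _ => isCompact_univ_pi fun _ => isCompact_Icc (a := (-1 : ℝ)) (b := 1))
      (isClosed_centralizer_Sp X) ?_
    rintro S ⟨hS, hSX⟩ i - j -
    have hU : S ∈ unitaryGroup (Fin n ⊕ Fin n) ℝ := by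
      rw [mem_unitaryGroup_iff', star_eq_conjTranspose, conjTranspose_eq_transpose_of_trivial]
      exact transpose_mul_self_of_mem_centralizer hX hXk h hS hSX
    exact abs_le.1 (entry_norm_bound_of_unitary hU i j)
  · let f : Module.End ℝ (Matrix (Fin n ⊕ Fin n) (Fin n ⊕ Fin n) ℝ) :=
      LinearMap.mulLeft ℝ X - LinearMap.mulRight ℝ X
    have hf : ∀ W ∈ cartanNoncompact n, f W ∈ cartanNoncompact n :=
      fun W hW => commutator_mem_cartanNoncompact hX hXk hW
    have hinj : Function.Injective (f.restrict hf) := by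
      rw [injective_iff_map_eq_zero]
      rintro ⟨W, hW⟩ h0
      exact Subtype.ext (h W hW.1 hW.2 (sub_eq_zero.1 (congrArg Subtype.val h0)))
    refine ⟨hf, fun A hA B hB hAB => ?_, fun B hB => ?_⟩
    · exact congrArg Subtype.val (@hinj ⟨A, hA⟩ ⟨B, hB⟩ (Subtype.ext hAB))
    · obtain ⟨⟨A, hA⟩, hAB⟩ := LinearMap.injective_iff_surjective.1 hinj ⟨B, hB⟩
      exact ⟨A, hA, congrArg Subtype.val hAB⟩
  · refine h.injOn ⟨hW, hW'⟩ (cartanNoncompact n).zero_mem ?_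
    simp [hXW]
end

section
/- The set ℰ = {X ∈ sp(2n,ℝ) : XΩ = ΩX and the centralizer {S ∈ Sp(2n,ℝ) : SX = XS} is compact} is an open subset of the unitary subalgebra 𝔨 = {X ∈ sp(2n,ℝ) : XΩ = ΩX} (with its subspace topology). -/
open Matrix

/-- The unitary subalgebra `𝔨 = {X ∈ sp(2n,ℝ) : X Ω = Ω X}`, the Lie algebra of the
maximal compact subgroup `U(n) ⊂ Sp(2n,ℝ)`. -/
noncomputable def unitarySubalg (n : ℕ) : Set (Matrix (Fin n ⊕ Fin n) (Fin n ⊕ Fin n) ℝ) :=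
  {X ∈ sp n | X * Omega n = Omega n * X}

theorem isClosed_setOf_exists_mem_of_isCompact {α β : Type*} [TopologicalSpace α]
    [TopologicalSpace β] {K : Set β} (hK : IsCompact K) {C : Set (α × β)} (hC : IsClosed C) :
    IsClosed {x | ∃ y ∈ K, (x, y) ∈ C} := by
  have : CompactSpace K := isCompact_iff_compactSpace.mp hK
  have h := isClosedMap_fst_of_compactSpace (X := α) (Y := K) _
    (hC.preimage (f := fun p : α × K => (p.1, (p.2 : β))) (by fun_prop))
  convert h using 1
  ext x
  simp

theorem Omega_mul_Omega (n : ℕ) : Omega n * Omega n = -1 := by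
  simp [Omega, Matrix.fromBlocks_multiply, ← Matrix.fromBlocks_one, Matrix.fromBlocks_neg]

theorem Omega_transpose (n : ℕ) : (Omega n)ᵀ = -Omega n := by
  simp [Omega, Matrix.fromBlocks_transpose, Matrix.fromBlocks_neg]

theorem transpose_eq_neg_of_mem_unitarySubalg {n : ℕ}
    {X : Matrix (Fin n ⊕ Fin n) (Fin n ⊕ Fin n) ℝ} (hX : X ∈ unitarySubalg n) : Xᵀ = -X := by
  obtain ⟨h1, h2⟩ := hX
  have h1 : Xᵀ * Omega n + Omega n * X = 0 := h1
  rw [← h2, ← add_mul] at h1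
  have h3 := congrArg (· * Omega n) h1
  simp only [mul_assoc, Omega_mul_Omega, zero_mul, mul_neg, mul_one, neg_eq_zero] at h3
  exact eq_neg_of_add_eq_zero_left h3

theorem mul_Omega_mul_transpose_of_mem_Sp {n : ℕ}
    {S : Matrix (Fin n ⊕ Fin n) (Fin n ⊕ Fin n) ℝ} (hS : S ∈ Sp n) :
    S * Omega n * Sᵀ = Omega n := by
  have hS : Sᵀ * Omega n * S = Omega n := hS
  have h1 : (-(Omega n * Sᵀ * Omega n)) * S = 1 := by
    rw [neg_mul, mul_assoc, mul_assoc, ← mul_assoc Sᵀ, hS, Omega_mul_Omega, neg_neg]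
  have h2 := congrArg (· * Omega n) (mul_eq_one_comm.mp h1)
  simpa only [mul_neg, neg_mul, mul_assoc, Omega_mul_Omega, mul_one, one_mul, neg_neg] using h2

/-- The symmetric part `𝔭` of the Cartan decomposition `sp(2n, ℝ) = 𝔨 ⊕ 𝔭`. -/
def cartanSymmetricPart (n : ℕ) : Set (Matrix (Fin n ⊕ Fin n) (Fin n ⊕ Fin n) ℝ) :=
  {Y | Yᵀ = Y ∧ Y * Omega n = -(Omega n * Y)}

theorem smul_mem_cartanSymmetricPart {n : ℕ} {Y : Matrix (Fin n ⊕ Fin n) (Fin n ⊕ Fin n) ℝ}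
    (hY : Y ∈ cartanSymmetricPart n) (t : ℝ) : t • Y ∈ cartanSymmetricPart n := by
  obtain ⟨h1, h2⟩ := hY
  exact ⟨by rw [transpose_smul, h1], by rw [smul_mul_assoc, h2, mul_smul_comm, smul_neg]⟩

theorem isClosed_cartanSymmetricPart (n : ℕ) : IsClosed (cartanSymmetricPart n) :=
  (isClosed_eq (by fun_prop) (by fun_prop)).inter (isClosed_eq (by fun_prop) (by fun_prop))

/-- The Cayley transform of an element of `𝔭` commuting with `X` is a symplectic matrix
commuting with `X`. -/
theorem exists_cayley {n : ℕ} {X Y : Matrix (Fin n ⊕ Fin n) (Fin n ⊕ Fin n) ℝ}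
    (hY : Y ∈ cartanSymmetricPart n) (hXY : Y * X = X * Y) (hdet : IsUnit (1 - Y)) :
    ∃ S ∈ {S ∈ Sp n | S * X = X * S}, S * (1 - Y) = 1 + Y := by
  obtain ⟨hT, hΩ⟩ := hY
  obtain ⟨S, hS⟩ : ∃ S, S * (1 - Y) = 1 + Y := by
    obtain ⟨u, hu⟩ := hdet
    exact ⟨(1 + Y) * (u⁻¹).1, by rw [← hu, mul_assoc, Units.inv_mul, mul_one]⟩
  have hA : (1 - Y)ᵀ = 1 - Y := by simp [hT]
  refine ⟨S, ⟨?_, ?_⟩, hS⟩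
  · have hST : (1 - Y) * Sᵀ = 1 + Y := by
      have := congrArg transpose hS
      rwa [transpose_mul, hA, transpose_add, transpose_one, hT] at this
    change Sᵀ * Omega n * S = Omega n
    apply hdet.mul_left_cancel
    apply hdet.mul_right_cancel
    calc (1 - Y) * (Sᵀ * Omega n * S) * (1 - Y)
        = ((1 - Y) * Sᵀ) * Omega n * (S * (1 - Y)) := by simp only [mul_assoc]
      _ = (1 + Y) * Omega n * (1 + Y) := by rw [hST, hS]
      _ = (1 - Y) * Omega n * (1 - Y) := by
        have : Omega n * Y = -(Y * Omega n) := by rw [hΩ, neg_neg]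
        simp only [add_mul, sub_mul, mul_add, mul_sub, mul_one, one_mul, mul_assoc, this]
        abel
  · apply hdet.mul_right_cancel
    calc S * X * (1 - Y) = S * (1 - Y) * X := by
          rw [mul_assoc, mul_assoc, mul_sub, sub_mul, hXY, mul_one, one_mul]
      _ = X * (1 + Y) := by rw [hS, mul_add, add_mul, hXY, mul_one, one_mul]
      _ = X * S * (1 - Y) := by rw [mul_assoc, hS]

theorem dense_setOf_isUnit_one_sub_smul {m : Type*} [Fintype m] [DecidableEq m]
    (Y : Matrix m m ℝ) : Dense {t : ℝ | IsUnit (1 - t • Y)} := by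
  have hne : Y.charpolyRev ≠ 0 := by
    intro h
    have := Y.eval_charpolyRev
    simp [h] at this
  have hfin : {t : ℝ | Y.charpolyRev.IsRoot t}.Finite := Polynomial.finite_setOfPred_isRoot hne
  refine (hfin.countable.dense_compl ℝ).mono fun t ht => ?_
  have h : Y.charpolyRev.eval t = (1 - t • Y).det := by
    rw [charpolyRev, ← Polynomial.coe_evalRingHom, RingHom.map_det]
    congr 1
    ext i j
    simp [Matrix.one_apply, apply_ite, mul_comm t]
  rw [Set.mem_ofPred_eq, Matrix.isUnit_iff_isUnit_det, isUnit_iff_ne_zero, ← h]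
  exact ht

theorem eq_zero_of_isCompact_centralizer {n : ℕ}
    {X Y : Matrix (Fin n ⊕ Fin n) (Fin n ⊕ Fin n) ℝ}
    (hK : IsCompact {S ∈ Sp n | S * X = X * S})
    (hY : Y ∈ cartanSymmetricPart n) (hXY : Y * X = X * Y) : Y = 0 := by
  have hcl : IsClosed {t : ℝ | ∃ S ∈ {S ∈ Sp n | S * X = X * S},
      (t, S) ∈ {p : ℝ × Matrix (Fin n ⊕ Fin n) (Fin n ⊕ Fin n) ℝ |
        p.2 * (1 - p.1 • Y) = 1 + p.1 • Y}} :=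
    isClosed_setOf_exists_mem_of_isCompact hK (isClosed_eq (by fun_prop) (by fun_prop))
  have hall := hcl.closure_eq.symm.trans
    ((dense_setOf_isUnit_one_sub_smul Y).mono fun t ht =>
      exists_cayley (X := X) (smul_mem_cartanSymmetricPart hY t)
        (by rw [smul_mul_assoc, hXY, mul_smul_comm]) ht).closure_eq
  have hH : Y.IsHermitian := by
    rw [Matrix.IsHermitian, conjTranspose_eq_transpose_of_trivial, hY.1]
  rw [← hH.eigenvalues_eq_zero_iff]
  ext i
  by_contra hi
  have hi : hH.eigenvalues i ≠ 0 := hi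
  obtain ⟨S, -, hS⟩ := Set.eq_univ_iff_forall.mp hall (hH.eigenvalues i)⁻¹
  have hS : S * (1 - (hH.eigenvalues i)⁻¹ • Y) = 1 + (hH.eigenvalues i)⁻¹ • Y := hS
  set v := WithLp.ofLp (hH.eigenvectorBasis i) with hv
  have hYv : ((hH.eigenvalues i)⁻¹ • Y) *ᵥ v = v := by
    rw [smul_mulVec, hH.mulVec_eigenvectorBasis, smul_smul, inv_mul_cancel₀ hi, one_smul]
  have h := congrArg (· *ᵥ v) hS
  simp only [← mulVec_mulVec, sub_mulVec, add_mulVec, one_mulVec, hYv, sub_self,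
    mulVec_zero] at h
  have hv0 : v = 0 := by
    rw [← two_smul ℝ v] at h
    exact (smul_eq_zero.mp h.symm).resolve_left two_ne_zero
  exact hH.eigenvectorBasis.orthonormal.ne_zero i (by
    ext j
    exact congrFun hv0 j)

theorem transpose_mul_self_eq_one_of_centralizes {n : ℕ}
    {X S : Matrix (Fin n ⊕ Fin n) (Fin n ⊕ Fin n) ℝ} (hX : X ∈ unitarySubalg n)
    (h : ∀ Y ∈ cartanSymmetricPart n, Y * X = X * Y → Y = 0)
    (hS : S ∈ Sp n) (hSX : S * X = X * S) : Sᵀ * S = 1 := by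
  have hXt := transpose_eq_neg_of_mem_unitarySubalg hX
  have hSt : Sᵀ * X = X * Sᵀ := by
    have := congrArg transpose hSX
    rw [transpose_mul, transpose_mul, hXt, neg_mul, mul_neg, neg_inj] at this
    exact this.symm
  set P := Sᵀ * S with hP
  have hPt : Pᵀ = P := by rw [hP, transpose_mul, transpose_transpose]
  have hPX : P * X = X * P := by
    rw [hP, mul_assoc, hSX, ← mul_assoc, hSt, mul_assoc]
  have hPΩ : P * (Omega n * P) = Omega n := by
    calc P * (Omega n * P) = Sᵀ * (S * Omega n * Sᵀ) * S := by simp only [hP, mul_assoc]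
      _ = Omega n := by rw [mul_Omega_mul_transpose_of_mem_Sp hS]; exact hS
  have hXΩ : X * Omega n = Omega n * X := hX.2
  have hY := h (P + Omega n * P * Omega n) ⟨by
      simp [transpose_mul, Omega_transpose, hPt, mul_assoc], by
      have h1 : Omega n * (Omega n * (P * Omega n)) = -(P * Omega n) := by
        rw [← mul_assoc, Omega_mul_Omega, neg_mul, one_mul]
      simp only [add_mul, mul_add, mul_assoc, Omega_mul_Omega, h1, mul_neg, mul_one]
      abel⟩ (by
      calc (P + Omega n * P * Omega n) * X = P * X + Omega n * (P * (Omega n * X)) := by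
            simp only [add_mul, mul_assoc]
        _ = X * P + Omega n * (P * X) * Omega n := by rw [← hXΩ, hPX]; simp only [← mul_assoc, hPX]
        _ = X * (P + Omega n * P * Omega n) := by
            rw [hPX, ← mul_assoc (Omega n), ← hXΩ, mul_add]; simp only [mul_assoc])
  have hPP : P * P = 1 := by
    have := congrArg (P * ·) hY
    simp only [mul_add, mul_zero] at this
    rw [← mul_assoc P (Omega n * P), hPΩ, Omega_mul_Omega] at this
    simpa [add_neg_eq_zero] using this
  have hunit : IsUnit (P + 1) := by
    have hpsd : P.PosSemidef := by
      have := Matrix.posSemidef_conjTranspose_mul_self S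
      rwa [conjTranspose_eq_transpose_of_trivial] at this
    exact (Matrix.PosDef.posSemidef_add hpsd Matrix.PosDef.one).isUnit
  apply sub_eq_zero.mp
  apply hunit.mul_left_cancel
  rw [mul_zero, mul_sub, add_mul, hPP]
  simp [add_comm]

section

attribute [local instance] Matrix.normedAddCommGroup Matrix.normedSpace

theorem isCompact_setOf_transpose_mul_self_eq_one (m : Type*) [Fintype m] [DecidableEq m] :
    IsCompact {S : Matrix m m ℝ | Sᵀ * S = 1} := by
  have : ProperSpace (Matrix m m ℝ) := inferInstanceAs (ProperSpace (m → m → ℝ))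
  refine Metric.isCompact_of_isClosed_isBounded
    (isClosed_eq (by fun_prop) (by fun_prop)) ?_
  refine (Metric.isBounded_closedBall (x := 0) (r := 1)).subset fun S hS => ?_
  rw [mem_closedBall_zero_iff]
  refine entrywise_sup_norm_bound_of_unitary (𝕜 := ℝ) ?_
  rw [Matrix.mem_unitaryGroup_iff', star_eq_conjTranspose, conjTranspose_eq_transpose_of_trivial]
  exact hS

theorem isOpen_setOf_forall_commute_eq_zero (n : ℕ) :
    IsOpen {X : unitarySubalg n | ∀ Y ∈ cartanSymmetricPart n, Y * X.1 = X.1 * Y → Y = 0} := by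
  have : ProperSpace (Matrix (Fin n ⊕ Fin n) (Fin n ⊕ Fin n) ℝ) :=
    inferInstanceAs (ProperSpace (Fin n ⊕ Fin n → Fin n ⊕ Fin n → ℝ))
  have hK : IsCompact (Metric.sphere (0 : Matrix (Fin n ⊕ Fin n) (Fin n ⊕ Fin n) ℝ) 1 ∩
      cartanSymmetricPart n) :=
    (isCompact_sphere _ _).inter_right (isClosed_cartanSymmetricPart n)
  have hcl := isClosed_setOf_exists_mem_of_isCompact hK
    (C := {p : unitarySubalg n × Matrix (Fin n ⊕ Fin n) (Fin n ⊕ Fin n) ℝ |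
      p.2 * (p.1 : Matrix (Fin n ⊕ Fin n) (Fin n ⊕ Fin n) ℝ) = p.1 * p.2})
    (isClosed_eq (by fun_prop) (by fun_prop))
  convert hcl.isOpen_compl using 1
  ext X
  rw [Set.mem_ofPred_eq, Set.mem_compl_iff, Set.mem_ofPred_eq]
  constructor
  · rintro h ⟨Y, ⟨hY1, hY⟩, hYX⟩
    rw [h Y hY hYX] at hY1
    simp at hY1
  · intro h Y hY hYX
    by_contra hY0
    refine h ⟨‖Y‖⁻¹ • Y, ⟨?_, smul_mem_cartanSymmetricPart hY _⟩, ?_⟩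
    · rw [mem_sphere_zero_iff_norm, norm_smul, norm_inv, norm_norm,
        inv_mul_cancel₀ (norm_ne_zero_iff.mpr hY0)]
    · change (‖Y‖⁻¹ • Y) * X.1 = X.1 * (‖Y‖⁻¹ • Y)
      rw [smul_mul_assoc, hYX, mul_smul_comm]

end

theorem isCompact_centralizer_iff {n : ℕ} {X : Matrix (Fin n ⊕ Fin n) (Fin n ⊕ Fin n) ℝ}
    (hX : X ∈ unitarySubalg n) :
    IsCompact {S ∈ Sp n | S * X = X * S} ↔
      ∀ Y ∈ cartanSymmetricPart n, Y * X = X * Y → Y = 0 := by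
  refine ⟨fun hK Y hY hXY => eq_zero_of_isCompact_centralizer hK hY hXY, fun h => ?_⟩
  refine (isCompact_setOf_transpose_mul_self_eq_one (Fin n ⊕ Fin n)).of_isClosed_subset ?_
    fun S hS => transpose_mul_self_eq_one_of_centralizes hX h hS.1 hS.2
  exact (isClosed_eq (by fun_prop) (by fun_prop)).inter (isClosed_eq (by fun_prop) (by fun_prop))

/-- The set `ℰ` of strongly stable elements lying in the unitary
subalgebra `𝔨` is an open subset of `𝔨` (with its subspace topology). -/
theorem stronglyStable_isOpen_in_unitarySubalg (n : ℕ) :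
    IsOpen {X : (unitarySubalg n) | IsCompact {S ∈ Sp n |
      S * (X : Matrix (Fin n ⊕ Fin n) (Fin n ⊕ Fin n) ℝ)
        = (X : Matrix (Fin n ⊕ Fin n) (Fin n ⊕ Fin n) ℝ) * S}} := by
  convert isOpen_setOf_forall_commute_eq_zero n using 1
  ext X
  exact isCompact_centralizer_iff X.2
end
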